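/- For every α ∈ (0,1), the function √(QJRD_α) is a metric on the set of d×d complex Hermitian positive definite matrices of unit trace: for all such X, Y, Z, QJRD_α(X,Y) ≥ 0 with equality iff X = Y, QJRD_α(X,Y) = QJRD_α(Y,X), and √(QJRD_α(X,Z)) ≤ √(QJRD_α(X,Y)) + √(QJRD_α(Y,Z)). -/

import Mathlib

open MeasureTheory Matrix
open scoped ComplexOrder

/-- `tr g(X)` for a Hermitian matrix `X`: the sum of `g` over the eigenvalues of `X`. -/
noncomputable def traceF {d : ℕ} (g : ℝ → ℝ) (X : Matrix (Fin d) (Fin d) ℂ) : ℝ :=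
  if hX : X.IsHermitian then ∑ i, g (hX.eigenvalues i) else 0

/-- The quantum Rényi entropy `H_α(X) = (1/(1−α))·log(tr(X^α)/tr(X))`. -/
noncomputable def renyiEntropy {d : ℕ} (α : ℝ) (X : Matrix (Fin d) (Fin d) ℂ) : ℝ :=
  (1 / (1 - α)) * Real.log (traceF (fun x => x ^ α) X / X.trace.re)

/-- The quantum Jensen-Rényi divergence
`QJRD_α(X,Y) = H_α((X+Y)/2) − (1/2)H_α(X) − (1/2)H_α(Y)`. -/
noncomputable def qjrd {d : ℕ} (α : ℝ) (X Y : Matrix (Fin d) (Fin d) ℂ) : ℝ :=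
  renyiEntropy α ((1 / 2 : ℝ) • (X + Y))
    - (1 / 2) * renyiEntropy α X - (1 / 2) * renyiEntropy α Y

lemma Real.mul_tanh_le_two_mul_log_cosh {u : ℝ} (hu : 0 ≤ u) :
    u * Real.tanh u ≤ 2 * Real.log (Real.cosh u) := by
  have hd : ∀ x : ℝ, HasDerivAt (fun x => 2 * Real.log (Real.cosh x) - x * (Real.sinh x / Real.cosh x))
      (2 * (Real.sinh x / Real.cosh x) - (1 * (Real.sinh x / Real.cosh x) + x *
        ((Real.cosh x * Real.cosh x - Real.sinh x * Real.sinh x) / Real.cosh x ^ 2))) x := fun x =>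
    (((Real.hasDerivAt_cosh x).log (Real.cosh_pos x).ne').const_mul 2).sub
      ((hasDerivAt_id x).mul ((Real.hasDerivAt_sinh x).div (Real.hasDerivAt_cosh x)
        (Real.cosh_pos x).ne'))
  have hm : MonotoneOn (fun x => 2 * Real.log (Real.cosh x) - x * (Real.sinh x / Real.cosh x))
      (Set.Ici 0) := by
    refine monotoneOn_of_hasDerivWithinAt_nonneg (convex_Ici 0)
      (fun x _ => (hd x).continuousAt.continuousWithinAt)
      (fun x _ => (hd x).hasDerivWithinAt) fun x hx => ?_
    rw [interior_Ici, Set.mem_Ioi] at hx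
    have hc := Real.cosh_pos x
    have hs : x ≤ Real.sinh x := Real.self_le_sinh_iff.2 hx.le
    have h1 := Real.one_le_cosh x
    have h2 := Real.cosh_sq x
    have : 2 * (Real.sinh x / Real.cosh x) - (1 * (Real.sinh x / Real.cosh x) + x *
        ((Real.cosh x * Real.cosh x - Real.sinh x * Real.sinh x) / Real.cosh x ^ 2)) =
        (Real.sinh x * Real.cosh x - x) / Real.cosh x ^ 2 := by
      have h3 : Real.cosh x * Real.cosh x - Real.sinh x * Real.sinh x = 1 := by nlinarith
      rw [h3]; field_simp; ring
    rw [this]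
    apply div_nonneg _ (by positivity)
    nlinarith [mul_nonneg (hx.le.trans hs) (sub_nonneg.2 h1)]
  have := hm (Set.mem_Ici.2 le_rfl) (Set.mem_Ici.2 hu) hu
  simp only [Real.cosh_zero, Real.log_one, Real.sinh_zero] at this
  rw [Real.tanh_eq_sinh_div_cosh]
  linarith

lemma Real.antitoneOn_log_cosh_div_sq :
    AntitoneOn (fun u => Real.log (Real.cosh u) / u ^ 2) (Set.Ioi 0) := by
  have hd : ∀ x : ℝ, 0 < x → HasDerivAt (fun u => Real.log (Real.cosh u) / u ^ 2)
      ((Real.sinh x / Real.cosh x * x ^ 2 - Real.log (Real.cosh x) * (2 * x)) / (x ^ 2) ^ 2) x := by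
    intro x hx
    refine ((Real.hasDerivAt_cosh x).log (Real.cosh_pos x).ne').div ?_ (by positivity)
    simpa using hasDerivAt_pow 2 x
  refine antitoneOn_of_hasDerivWithinAt_nonpos (convex_Ioi 0)
      (fun x hx => (hd x hx).continuousAt.continuousWithinAt)
      (fun x hx => (hd x (interior_subset hx)).hasDerivWithinAt) fun x hx => ?_
  rw [interior_Ioi, Set.mem_Ioi] at hx
  apply div_nonpos_of_nonpos_of_nonneg _ (by positivity)
  have := Real.mul_tanh_le_two_mul_log_cosh hx.le
  rw [Real.tanh_eq_sinh_div_cosh] at this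
  nlinarith

/-- `√(log cosh)` is subadditive. -/
lemma Real.log_cosh_add_le {a b u v : ℝ} (ha : 0 ≤ a) (hb : 0 ≤ b) (hu : 0 ≤ u) (hv : 0 ≤ v) :
    a * b * Real.log (Real.cosh (u + v)) ≤
      (a + b) * (a * Real.log (Real.cosh u) + b * Real.log (Real.cosh v)) := by
  have key : ∀ x y : ℝ, 0 ≤ x → x ≤ y → 0 < y →
      x ^ 2 * (Real.log (Real.cosh y) / y ^ 2) ≤ Real.log (Real.cosh x) := by
    intro x y hx hxy hy
    rcases hx.eq_or_lt with rfl | hx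
    · simp
    · have := Real.antitoneOn_log_cosh_div_sq (Set.mem_Ioi.2 hx) (Set.mem_Ioi.2 hy) hxy
      rw [le_div_iff₀ (by positivity)] at this
      simpa [mul_comm] using this
  rcases (add_nonneg hu hv).eq_or_lt with h | h
  · have hu0 : u = 0 := by linarith
    have hv0 : v = 0 := by linarith
    simp [hu0, hv0]
  · have h1 := key u (u + v) hu (by linarith) h
    have h2 := key v (u + v) hv (by linarith) h
    set r := Real.log (Real.cosh (u + v)) / (u + v) ^ 2 with hr
    have hr0 : 0 ≤ r := div_nonneg (Real.log_nonneg (Real.one_le_cosh _)) (by positivity)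
    have hr' : Real.log (Real.cosh (u + v)) = (u + v) ^ 2 * r := by rw [hr]; field_simp
    rw [hr']
    have h3 : (a + b) * (a * (u ^ 2 * r) + b * (v ^ 2 * r)) ≤
        (a + b) * (a * Real.log (Real.cosh u) + b * Real.log (Real.cosh v)) := by gcongr
    nlinarith [mul_nonneg hr0 (sq_nonneg (a * u - b * v))]

lemma Real.log_cosh_sub_le {a b x y z : ℝ} (ha : 0 ≤ a) (hb : 0 ≤ b) :
    a * b * Real.log (Real.cosh (x - z)) ≤
      (a + b) * (a * Real.log (Real.cosh (x - y)) + b * Real.log (Real.cosh (y - z))) := by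
  rw [← Real.cosh_abs (x - y), ← Real.cosh_abs (y - z)]
  refine le_trans ?_ (Real.log_cosh_add_le ha hb (abs_nonneg (x - y)) (abs_nonneg (y - z)))
  refine mul_le_mul_of_nonneg_left (Real.log_le_log (Real.cosh_pos _) ?_) (by positivity)
  rw [Real.cosh_le_cosh, abs_of_nonneg (by positivity : 0 ≤ |x - y| + |y - z|)]
  exact abs_sub_le x y z

lemma Real.log_cosh_half_log_sub {x y : ℝ} (hx : 0 < x) (hy : 0 < y) :
    Real.log (Real.cosh (Real.log x / 2 - Real.log y / 2)) =
      Real.log (x + y) - Real.log 2 - Real.log x / 2 - Real.log y / 2 := by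
  have h : Real.cosh (Real.log x / 2 - Real.log y / 2) =
      (x + y) / (2 * (Real.exp (Real.log x / 2) * Real.exp (Real.log y / 2))) := by
    have hx2 : Real.exp (Real.log x / 2) ^ 2 = x := by
      rw [← Real.exp_nat_mul]; push_cast; rw [mul_div_cancel₀ _ two_ne_zero, Real.exp_log hx]
    have hy2 : Real.exp (Real.log y / 2) ^ 2 = y := by
      rw [← Real.exp_nat_mul]; push_cast; rw [mul_div_cancel₀ _ two_ne_zero, Real.exp_log hy]
    rw [Real.cosh_eq, neg_sub, Real.exp_sub, Real.exp_sub]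
    have h1 := (Real.exp_pos (Real.log x / 2)).ne'
    have h2 := (Real.exp_pos (Real.log y / 2)).ne'
    field_simp
    rw [hx2, hy2]
  rw [h, Real.log_div (by positivity) (by positivity), Real.log_mul (by norm_num) (by positivity),
    Real.log_mul (by positivity) (by positivity), Real.log_exp, Real.log_exp]
  ring

/-- The scalar `S`-divergence satisfies the squared triangle inequality. -/
lemma Real.log_add_triangle {a b x y z : ℝ} (ha : 0 ≤ a) (hb : 0 ≤ b) (hx : 0 < x) (hy : 0 < y)
    (hz : 0 < z) :
    a * b * (Real.log (x + z) - Real.log 2 - Real.log x / 2 - Real.log z / 2) ≤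
      (a + b) * (a * (Real.log (x + y) - Real.log 2 - Real.log x / 2 - Real.log y / 2) +
        b * (Real.log (y + z) - Real.log 2 - Real.log y / 2 - Real.log z / 2)) := by
  rw [← Real.log_cosh_half_log_sub hx hy, ← Real.log_cosh_half_log_sub hx hz,
    ← Real.log_cosh_half_log_sub hy hz]
  exact Real.log_cosh_sub_le ha hb

lemma Matrix.IsHermitian.exists_unitary_diagonal {n : Type*} [Fintype n] [DecidableEq n]
    {A : Matrix n n ℂ} (hA : A.IsHermitian) :
    ∃ U : Matrix n n ℂ, IsUnit U ∧ Uᴴ * U = 1 ∧ U * Uᴴ = 1 ∧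
      A = U * diagonal (fun i => (hA.eigenvalues i : ℂ)) * Uᴴ :=
  ⟨hA.eigenvectorUnitary, IsUnit.of_mul_eq_one _ (Unitary.coe_mul_star_self _),
    Unitary.coe_star_mul_self _, Unitary.coe_mul_star_self _, hA.spectral_theorem⟩

/-- A positive definite and a Hermitian matrix are simultaneously diagonalized by a congruence. -/
lemma Matrix.PosDef.exists_congr_one_diagonal {n : Type*} [Fintype n] [DecidableEq n]
    {A C : Matrix n n ℂ} (hA : A.PosDef) (hC : C.IsHermitian) :
    ∃ (T : Matrix n n ℂ) (c : n → ℝ), IsUnit T ∧ T * A * Tᴴ = 1 ∧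
      T * C * Tᴴ = diagonal (fun i => (c i : ℂ)) := by
  obtain ⟨S, hSu, hSA⟩ : ∃ S : Matrix n n ℂ, IsUnit S ∧ S * A * Sᴴ = 1 := by
    obtain ⟨U, hUu, hUU, -, hU⟩ := hA.isHermitian.exists_unitary_diagonal
    set e := hA.isHermitian.eigenvalues
    have he : ∀ i, 0 < e i := hA.eigenvalues_pos
    set R := diagonal (fun i => ((√(e i))⁻¹ : ℂ)) with hR
    have hd : Rᴴ = R := by
      rw [hR, diagonal_conjTranspose]; congr 1; ext i; simp [Complex.conj_ofReal]
    refine ⟨R * Uᴴ, ?_, ?_⟩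
    · refine IsUnit.mul ?_ (IsUnit.of_mul_eq_one _ hUU)
      rw [isUnit_diagonal, Pi.isUnit_iff]
      intro i
      have := (Real.sqrt_pos.2 (he i)).ne'
      simpa using this
    · calc R * Uᴴ * A * (R * Uᴴ)ᴴ
          = R * (Uᴴ * U) * diagonal (fun i => (e i : ℂ)) * (Uᴴ * U) * R := by
            rw [hU]
            simp only [conjTranspose_mul, conjTranspose_conjTranspose, hd, Matrix.mul_assoc]
        _ = 1 := by
          rw [hUU, Matrix.mul_one, Matrix.mul_one, diagonal_mul_diagonal, diagonal_mul_diagonal,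
            ← diagonal_one]
          congr 1; ext i
          have h1 := (Real.sqrt_pos.2 (he i)).ne'
          have h2 := Real.sq_sqrt (he i).le
          have : ((√(e i))⁻¹ * e i * (√(e i))⁻¹ : ℝ) = 1 := by
            field_simp; linarith
          simpa using congrArg (fun x : ℝ => (x : ℂ)) this
  have hH : (S * C * Sᴴ).IsHermitian := by
    simp [IsHermitian, hC.eq, Matrix.mul_assoc]
  obtain ⟨V, -, hVV, -, hV⟩ := hH.exists_unitary_diagonal
  refine ⟨Vᴴ * S, hH.eigenvalues, (IsUnit.of_mul_eq_one _ hVV).mul hSu, ?_, ?_⟩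
  · calc Vᴴ * S * A * (Vᴴ * S)ᴴ = Vᴴ * (S * A * Sᴴ) * V := by
          simp only [conjTranspose_mul, conjTranspose_conjTranspose, Matrix.mul_assoc]
      _ = 1 := by rw [hSA, Matrix.mul_one, hVV]
  · set D := diagonal (fun i => (hH.eigenvalues i : ℂ))
    calc Vᴴ * S * C * (Vᴴ * S)ᴴ = Vᴴ * (S * C * Sᴴ) * V := by
          simp only [conjTranspose_mul, conjTranspose_conjTranspose, Matrix.mul_assoc]
      _ = (Vᴴ * V) * D * (Vᴴ * V) := by
          rw [hV]; simp only [Matrix.mul_assoc]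
      _ = D := by rw [hVV, Matrix.mul_one, Matrix.one_mul]

lemma Matrix.norm_det_congr {n : Type*} [Fintype n] [DecidableEq n] (T A : Matrix n n ℂ) :
    ‖(T * A * Tᴴ).det‖ = ‖T.det‖ ^ 2 * ‖A.det‖ := by
  simp only [det_mul, det_conjTranspose, norm_mul, norm_star]; ring

lemma Matrix.norm_det_diagonal_ofReal {n : Type*} [Fintype n] [DecidableEq n] {c : n → ℝ}
    (hc : ∀ i, 0 ≤ c i) : ‖(diagonal (fun i => (c i : ℂ))).det‖ = ∏ i, c i := by
  rw [det_diagonal, norm_prod]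
  exact Finset.prod_congr rfl fun i _ => by simp [abs_of_nonneg (hc i)]

lemma Matrix.PosDef.norm_det_le_add {n : Type*} [Fintype n] [DecidableEq n]
    {A P : Matrix n n ℂ} (hA : A.PosDef) (hP : P.PosSemidef) :
    ‖A.det‖ ≤ ‖(A + P).det‖ := by
  obtain ⟨T, p, hT, hTA, hTP⟩ := hA.exists_congr_one_diagonal hP.isHermitian
  have hp : ∀ i, 0 ≤ p i := by
    have := hP.mul_mul_conjTranspose_same T
    rw [hTP, posSemidef_diagonal_iff] at this
    exact fun i => by exact_mod_cast this i
  have h0 : 0 < ‖T.det‖ ^ 2 := by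
    have := (isUnit_iff_isUnit_det T).1 hT
    have := norm_pos_iff.2 this.ne_zero
    positivity
  refine le_of_mul_le_mul_left ?_ h0
  rw [← norm_det_congr, ← norm_det_congr, mul_add, add_mul, hTA, hTP]
  have : (1 : Matrix n n ℂ) + diagonal (fun i => (p i : ℂ)) =
      diagonal (fun i => ((1 + p i : ℝ) : ℂ)) := by
    rw [← diagonal_one, diagonal_add]; simp
  rw [this, norm_det_diagonal_ofReal fun i => by linarith [hp i]]
  simpa using Finset.prod_le_prod (s := Finset.univ) (f := fun _ => (1 : ℝ))
    (g := fun i => 1 + p i) (by simp) (by simpa using hp)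

/-- The pivots of a positive definite matrix: positive numbers `D i` with product `det B` such that
adding a nonnegative diagonal matrix to `B` increases the determinant at least as much as adding it
to `diagonal D`. -/
lemma Matrix.PosDef.exists_pivots {n : ℕ} {B : Matrix (Fin n) (Fin n) ℂ} (hB : B.PosDef) :
    ∃ D : Fin n → ℝ, (∀ i, 0 < D i) ∧ ∏ i, D i = ‖B.det‖ ∧
      ∀ c : Fin n → ℝ, (∀ i, 0 ≤ c i) →
        ∏ i, (c i + D i) ≤ ‖(diagonal (fun i => (c i : ℂ)) + B).det‖ := by
  induction n with
  | zero => exact ⟨fun _ => 1, by simp, by simp, by simp⟩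
  | succ n ih =>
    let e : Fin n ⊕ Fin 1 ≃ Fin (n + 1) := finSumFinEquiv
    set B' := B.submatrix e e with hB'
    have hB'p : B'.PosDef := hB.submatrix e.injective
    set M := B'.toBlocks₁₁
    set v := B'.toBlocks₁₂ with hv
    have hv' : B'.toBlocks₂₁ = vᴴ := by
      ext i j
      simpa [hv, toBlocks₁₂, toBlocks₂₁] using (hB'p.isHermitian.apply (Sum.inr i) (Sum.inl j)).symm
    have hpos : (0 : ℂ) < B' (Sum.inr 0) (Sum.inr 0) := hB'p.diag_pos
    obtain ⟨β, hβ, hβe⟩ : ∃ β : ℝ, 0 < β ∧ B' (Sum.inr 0) (Sum.inr 0) = β := by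
      refine ⟨(B' (Sum.inr 0) (Sum.inr 0)).re, (Complex.lt_def.1 hpos).1, ?_⟩
      apply Complex.ext <;> simp [(Complex.lt_def.1 hpos).2.symm]
    have hb : B'.toBlocks₂₂ = diagonal (fun _ : Fin 1 => (β : ℂ)) := by
      ext i j
      rw [Subsingleton.elim i 0, Subsingleton.elim j 0]
      simp [toBlocks₂₂, hβe]
    have hblock : B' = fromBlocks M v vᴴ (diagonal (fun _ : Fin 1 => (β : ℂ))) := by
      rw [← hv', ← hb, fromBlocks_toBlocks]
    have hdet : ∀ (N : Matrix (Fin n) (Fin n) ℂ) (t : ℝ), 0 < t →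
        ‖(fromBlocks N v vᴴ (diagonal (fun _ : Fin 1 => (t : ℂ)))).det‖ =
          t * ‖(N - v * diagonal (fun _ : Fin 1 => ((t⁻¹ : ℝ) : ℂ)) * vᴴ).det‖ := by
      intro N t ht
      have ht' : (t : ℂ) ≠ 0 := by exact_mod_cast ht.ne'
      let _ : Invertible (diagonal (fun _ : Fin 1 => (t : ℂ))) :=
        ⟨diagonal (fun _ : Fin 1 => ((t⁻¹ : ℝ) : ℂ)),
          by rw [diagonal_mul_diagonal, ← diagonal_one]; simp [ht'],
          by rw [diagonal_mul_diagonal, ← diagonal_one]; simp [ht']⟩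
      rw [det_fromBlocks₂₂, norm_mul, det_diagonal]
      simp only [Finset.univ_unique, Finset.prod_singleton, Complex.norm_real, Real.norm_eq_abs,
        abs_of_pos ht]
      rfl
    set M' := M - v * diagonal (fun _ : Fin 1 => ((β⁻¹ : ℝ) : ℂ)) * vᴴ with hM'
    have hdB : ‖B.det‖ = β * ‖M'.det‖ := by
      rw [← det_submatrix_equiv_self e B, ← hB', hblock, hdet M β hβ]
    have hM'p : M'.PosDef := by
      have hdp : (diagonal (fun _ : Fin 1 => (β : ℂ))).PosDef := by
        rw [posDef_diagonal_iff]; intro _; exact_mod_cast hβ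
      have hinv : (diagonal (fun _ : Fin 1 => (β : ℂ)))⁻¹ =
          diagonal (fun _ : Fin 1 => ((β⁻¹ : ℝ) : ℂ)) := by
        apply inv_eq_left_inv
        rw [diagonal_mul_diagonal, ← diagonal_one]; simp [hβ.ne']
      let _ := hdp.isUnit.invertible
      have h1 : M'.PosSemidef := by
        have := (PosDef.fromBlocks₂₂ M v hdp).1 (hblock ▸ hB'p.posSemidef)
        rwa [hinv] at this
      rw [h1.posDef_iff_det_ne_zero]
      intro h0
      have := hB.det_pos.ne'
      rw [← norm_ne_zero_iff, hdB, h0] at this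
      simp at this
    obtain ⟨D, hD, hDd, hDc⟩ := ih hM'p
    refine ⟨fun i => Sum.elim D (fun _ => β) (e.symm i), ?_, ?_, ?_⟩
    · intro i
      change 0 < Sum.elim D (fun _ => β) (e.symm i)
      rcases e.symm i with j | j
      · exact hD j
      · exact hβ
    · rw [← Equiv.prod_comp e]
      simp [hdB, hDd, mul_comm]
    · intro c hc
      rw [← Equiv.prod_comp e, ← det_submatrix_equiv_self e]
      set c₁ : Fin n → ℝ := fun i => c (e (Sum.inl i))
      set γ : ℝ := c (e (Sum.inr 0))
      have hγ : 0 ≤ γ := hc _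
      have hsub : (diagonal (fun i => (c i : ℂ)) + B).submatrix e e =
          fromBlocks (diagonal (fun i => (c₁ i : ℂ)) + M) v vᴴ
            (diagonal (fun _ : Fin 1 => ((γ + β : ℝ) : ℂ))) := by
        have : (diagonal (fun i => (c i : ℂ)) + B).submatrix e e =
          (diagonal (fun i => (c i : ℂ))).submatrix e e + B' := rfl
        rw [this, submatrix_diagonal_equiv]
        conv_lhs => rw [hblock]
        ext (i | i) (j | j)
        · simp [c₁, diagonal_apply]
        · simp
        · simp
        · rw [Subsingleton.elim i 0, Subsingleton.elim j 0]; simp [γ]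
      rw [hsub, hdet _ _ (by positivity)]
      have hk : 0 ≤ β⁻¹ - (γ + β)⁻¹ := by
        rw [sub_nonneg]; exact inv_anti₀ hβ (by linarith)
      have hP : (v * diagonal (fun _ : Fin 1 => ((β⁻¹ - (γ + β)⁻¹ : ℝ) : ℂ)) * vᴴ).PosSemidef := by
        apply PosSemidef.mul_mul_conjTranspose_same
        rw [posSemidef_diagonal_iff]; intro _; exact_mod_cast hk
      have hC : (diagonal (fun i => (c₁ i : ℂ)) + M').PosDef := by
        refine PosDef.posSemidef_add ?_ hM'p
        rw [posSemidef_diagonal_iff]; intro _; exact_mod_cast hc _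
      have heq : diagonal (fun i => (c₁ i : ℂ)) + M -
          v * diagonal (fun _ : Fin 1 => (((γ + β)⁻¹ : ℝ) : ℂ)) * vᴴ =
          diagonal (fun i => (c₁ i : ℂ)) + M' +
            v * diagonal (fun _ : Fin 1 => ((β⁻¹ - (γ + β)⁻¹ : ℝ) : ℂ)) * vᴴ := by
        have : diagonal (fun _ : Fin 1 => ((β⁻¹ - (γ + β)⁻¹ : ℝ) : ℂ)) =
            diagonal (fun _ : Fin 1 => ((β⁻¹ : ℝ) : ℂ)) -
              diagonal (fun _ : Fin 1 => (((γ + β)⁻¹ : ℝ) : ℂ)) := by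
          rw [diagonal_sub]; simp
        rw [this, hM', Matrix.mul_sub, Matrix.sub_mul]; abel
      rw [heq]
      have h1 := hC.norm_det_le_add hP
      have h2 := hDc c₁ fun i => hc _
      simp only [Fintype.prod_sum_type, Equiv.symm_apply_apply, Sum.elim_inl, Sum.elim_inr,
        Finset.univ_unique, Finset.prod_singleton]
      rw [mul_comm]
      exact mul_le_mul_of_nonneg_left (h2.trans h1) (by positivity)

/-- The `S`-divergence `log det ((A + B) / 2) - (log det A + log det B) / 2`. -/
noncomputable def Matrix.sDivergence {n : ℕ} (A B : Matrix (Fin n) (Fin n) ℂ) : ℝ :=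
  Real.log ‖(A + B).det‖ - n * Real.log 2 - Real.log ‖A.det‖ / 2 - Real.log ‖B.det‖ / 2

lemma Matrix.PosDef.norm_det_pos {n : Type*} [Fintype n] [DecidableEq n] {A : Matrix n n ℂ}
    (hA : A.PosDef) : 0 < ‖A.det‖ :=
  norm_pos_iff.2 hA.det_pos.ne'

lemma Matrix.sDivergence_congr {n : ℕ} {A B T : Matrix (Fin n) (Fin n) ℂ} (hA : A.PosDef)
    (hB : B.PosDef) (hT : IsUnit T) :
    sDivergence (T * A * Tᴴ) (T * B * Tᴴ) = sDivergence A B := by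
  have hT' : ‖T.det‖ ^ 2 ≠ 0 :=
    pow_ne_zero _ (norm_ne_zero_iff.2 ((isUnit_iff_isUnit_det T).1 hT).ne_zero)
  unfold sDivergence
  rw [← add_mul, ← mul_add, norm_det_congr, norm_det_congr, norm_det_congr,
    Real.log_mul hT' hA.norm_det_pos.ne', Real.log_mul hT' hB.norm_det_pos.ne',
    Real.log_mul hT' (hA.add hB).norm_det_pos.ne']
  ring

lemma Matrix.sDivergence_diagonal {n : ℕ} {x y : Fin n → ℝ} (hx : ∀ i, 0 < x i)
    (hy : ∀ i, 0 < y i) :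
    sDivergence (diagonal fun i => (x i : ℂ)) (diagonal fun i => (y i : ℂ)) =
      ∑ i, (Real.log (x i + y i) - Real.log 2 - Real.log (x i) / 2 - Real.log (y i) / 2) := by
  have : (diagonal fun i => (x i : ℂ)) + (diagonal fun i => (y i : ℂ)) =
      diagonal fun i => ((x i + y i : ℝ) : ℂ) := by
    rw [diagonal_add]; simp
  unfold sDivergence
  rw [this, norm_det_diagonal_ofReal fun i => (hx i).le, norm_det_diagonal_ofReal fun i => (hy i).le,
    norm_det_diagonal_ofReal fun i => (add_pos (hx i) (hy i)).le,
    Real.log_prod fun i _ => (hx i).ne', Real.log_prod fun i _ => (hy i).ne',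
    Real.log_prod fun i _ => (add_pos (hx i) (hy i)).ne']
  simp [Finset.sum_sub_distrib, Finset.sum_div]

lemma Matrix.sDivergence_comm {n : ℕ} (A B : Matrix (Fin n) (Fin n) ℂ) :
    sDivergence A B = sDivergence B A := by
  unfold sDivergence; rw [add_comm]; ring

lemma Matrix.PosDef.sDivergence_triangle {n : ℕ} {A B C : Matrix (Fin n) (Fin n) ℂ}
    (hA : A.PosDef) (hB : B.PosDef) (hC : C.PosDef) {a b : ℝ} (ha : 0 ≤ a) (hb : 0 ≤ b) :
    a * b * sDivergence A C ≤ (a + b) * (a * sDivergence A B + b * sDivergence B C) := by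
  obtain ⟨T, c, hT, hTA, hTC⟩ := hA.exists_congr_one_diagonal hC.isHermitian
  have hcongr : ∀ {M : Matrix (Fin n) (Fin n) ℂ}, M.PosDef → (T * M * Tᴴ).PosDef := fun hM => by
    have := (Matrix.IsUnit.posDef_star_right_conjugate_iff (x := _) hT).2 hM
    simpa [star_eq_conjTranspose] using this
  have hc : ∀ i, 0 < c i := by
    have := hcongr hC
    rw [hTC, posDef_diagonal_iff] at this
    exact fun i => by exact_mod_cast this i
  obtain ⟨D, hD, hDdet, hDle⟩ := (hcongr hB).exists_pivots
  have hone : (1 : Matrix (Fin n) (Fin n) ℂ) = diagonal fun _ => ((1 : ℝ) : ℂ) := by simp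
  have hpiv : ∀ x : Fin n → ℝ, (∀ i, 0 < x i) →
      ∑ i, (Real.log (x i + D i) - Real.log 2 - Real.log (x i) / 2 - Real.log (D i) / 2) ≤
        sDivergence (diagonal fun i => (x i : ℂ)) (T * B * Tᴴ) := by
    intro x hx
    rw [← sDivergence_diagonal hx hD]
    unfold sDivergence
    rw [norm_det_diagonal_ofReal fun i => (hD i).le, hDdet]
    have h : Real.log ‖((diagonal fun i => (x i : ℂ)) + (diagonal fun i => (D i : ℂ))).det‖ ≤
        Real.log ‖((diagonal fun i => (x i : ℂ)) + T * B * Tᴴ).det‖ := by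
      have : (diagonal fun i => (x i : ℂ)) + (diagonal fun i => (D i : ℂ)) =
          diagonal fun i => ((x i + D i : ℝ) : ℂ) := by
        rw [diagonal_add]; simp
      rw [this, norm_det_diagonal_ofReal fun i => (add_pos (hx i) (hD i)).le]
      exact Real.log_le_log (Finset.prod_pos fun i _ => add_pos (hx i) (hD i))
        (hDle x fun i => (hx i).le)
    linarith
  rw [← sDivergence_congr hA hC hT, ← sDivergence_congr hA hB hT, ← sDivergence_congr hB hC hT,
    hTA, hTC, hone, sDivergence_diagonal (fun _ => one_pos) hc, sDivergence_comm (T * B * Tᴴ)]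
  have h1 := hpiv (fun _ => 1) fun _ => one_pos
  have h2 := hpiv c hc
  refine le_trans ?_ (mul_le_mul_of_nonneg_left (add_le_add (mul_le_mul_of_nonneg_left h1 ha)
    (mul_le_mul_of_nonneg_left h2 hb)) (add_nonneg ha hb))
  simp only [Finset.mul_sum, ← Finset.sum_add_distrib]
  refine Finset.sum_le_sum fun i _ => ?_
  have := Real.log_add_triangle ha hb one_pos (hD i) (hc i)
  rw [add_comm (D i) (c i)] at this
  linarith

lemma Matrix.PosDef.eq_of_sDivergence_nonpos {n : ℕ} {A C : Matrix (Fin n) (Fin n) ℂ}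
    (hA : A.PosDef) (hC : C.PosDef) (h : sDivergence A C ≤ 0) : A = C := by
  obtain ⟨T, c, hT, hTA, hTC⟩ := hA.exists_congr_one_diagonal hC.isHermitian
  have hc : ∀ i, 0 < c i := by
    have := (Matrix.IsUnit.posDef_star_right_conjugate_iff (x := _) hT).2 hC
    rw [star_eq_conjTranspose, hTC, posDef_diagonal_iff] at this
    exact fun i => by exact_mod_cast this i
  have hone : (1 : Matrix (Fin n) (Fin n) ℂ) = diagonal fun _ => ((1 : ℝ) : ℂ) := by simp
  have hterm : ∀ i, Real.log (1 + c i) - Real.log 2 - Real.log 1 / 2 - Real.log (c i) / 2 =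
      Real.log (Real.cosh (Real.log 1 / 2 - Real.log (c i) / 2)) := fun i =>
    (Real.log_cosh_half_log_sub one_pos (hc i)).symm
  rw [← sDivergence_congr hA hC hT, hTA, hTC, hone, sDivergence_diagonal (fun _ => one_pos) hc,
    Finset.sum_congr rfl fun i _ => hterm i] at h
  have hnn : ∀ i ∈ Finset.univ,
      0 ≤ Real.log (Real.cosh (Real.log 1 / 2 - Real.log (c i) / 2)) := fun i _ =>
    Real.log_nonneg (Real.one_le_cosh _)
  have h0 := (Finset.sum_eq_zero_iff_of_nonneg hnn).1 (h.antisymm (Finset.sum_nonneg hnn))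
  have hc1 : ∀ i, c i = 1 := by
    intro i
    have h1 := Real.eq_one_of_pos_of_log_eq_zero (Real.cosh_pos _) (h0 i (Finset.mem_univ i))
    have h2 : Real.log 1 / 2 - Real.log (c i) / 2 = 0 := by
      by_contra hne
      exact (Real.one_lt_cosh.2 hne).ne' h1
    rw [Real.log_one] at h2
    exact Real.eq_one_of_pos_of_log_eq_zero (hc i) (by linarith)
  have hTT : T * A * Tᴴ = T * C * Tᴴ := by
    rw [hTA, hTC]; simp [hc1]
  have hT' : IsUnit Tᴴ := by rw [← star_eq_conjTranspose]; exact hT.star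
  exact hT.mul_left_cancel (hT'.mul_right_cancel hTT)

section RpowIntegral

variable {α : ℝ}

lemma integrableOn_log_one_add_mul_rpow (hα : α ∈ Set.Ioo (0 : ℝ) 1) :
    IntegrableOn (fun u : ℝ => Real.log (1 + u) * u ^ (-α - 1)) (Set.Ioi 0) := by
  obtain ⟨h0, h1⟩ := hα
  have hmeas : Measurable fun u : ℝ => Real.log (1 + u) * u ^ (-α - 1) := by fun_prop
  rw [← Set.Ioc_union_Ioi_eq_Ioi (zero_le_one (α := ℝ)), integrableOn_union]
  constructor
  · have hi : IntegrableOn (fun u : ℝ => u ^ (-α)) (Set.Ioc 0 1) := by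
      rw [← intervalIntegrable_iff_integrableOn_Ioc_of_le zero_le_one]
      exact intervalIntegral.intervalIntegrable_rpow' (by linarith)
    refine Integrable.mono' hi hmeas.aestronglyMeasurable ?_
    filter_upwards [ae_restrict_mem measurableSet_Ioc] with u hu
    have hlog : 0 ≤ Real.log (1 + u) := Real.log_nonneg (by linarith [hu.1])
    have hle : Real.log (1 + u) ≤ u := by
      linarith [Real.log_le_sub_one_of_pos (show 0 < 1 + u by linarith [hu.1])]
    have hp := Real.rpow_pos_of_pos hu.1 (-α - 1)
    rw [Real.norm_eq_abs, abs_of_nonneg (by positivity)]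
    calc Real.log (1 + u) * u ^ (-α - 1) ≤ u * u ^ (-α - 1) := by gcongr
      _ = u ^ (-α) := by
        rw [← Real.rpow_one_add' hu.1.le (by linarith)]; congr 1; ring
  · have hi : IntegrableOn (fun u : ℝ => 2 ^ (α / 2) / (α / 2) * u ^ (-α / 2 - 1)) (Set.Ioi 1) :=
      (integrableOn_Ioi_rpow_of_lt (by linarith) one_pos).const_mul _
    refine Integrable.mono' hi hmeas.aestronglyMeasurable ?_
    filter_upwards [ae_restrict_mem measurableSet_Ioi] with u hu
    rw [Set.mem_Ioi] at hu
    have hu0 : 0 < u := by linarith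
    have hlog : 0 ≤ Real.log (1 + u) := Real.log_nonneg (by linarith)
    have hle : Real.log (1 + u) ≤ 2 ^ (α / 2) * u ^ (α / 2) / (α / 2) := by
      refine (Real.log_le_log (by linarith) (show 1 + u ≤ 2 * u by linarith)).trans ?_
      rw [← Real.mul_rpow zero_le_two hu0.le]
      exact Real.log_le_rpow_div (by positivity) (by positivity)
    have hp := Real.rpow_pos_of_pos hu0 (-α - 1)
    rw [Real.norm_eq_abs, abs_of_nonneg (by positivity)]
    calc Real.log (1 + u) * u ^ (-α - 1)
        ≤ 2 ^ (α / 2) * u ^ (α / 2) / (α / 2) * u ^ (-α - 1) := by gcongr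
      _ = 2 ^ (α / 2) / (α / 2) * (u ^ (α / 2) * u ^ (-α - 1)) := by ring
      _ = _ := by rw [← Real.rpow_add hu0]; ring_nf

/-- The constant `∫₀^∞ log (1 + u) u ^ (-α - 1) du`. -/
noncomputable def logRpowConst (α : ℝ) : ℝ :=
  ∫ u in Set.Ioi (0 : ℝ), Real.log (1 + u) * u ^ (-α - 1)

lemma logRpowConst_pos (hα : α ∈ Set.Ioo (0 : ℝ) 1) : 0 < logRpowConst α := by
  have hpos : ∀ u ∈ Set.Ioi (0 : ℝ), 0 < Real.log (1 + u) * u ^ (-α - 1) := fun u hu =>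
    mul_pos (Real.log_pos (by linarith [Set.mem_Ioi.1 hu])) (Real.rpow_pos_of_pos hu _)
  unfold logRpowConst
  rw [setIntegral_pos_iff_support_of_nonneg_ae _ (integrableOn_log_one_add_mul_rpow hα)]
  · have : Set.Ioi (0 : ℝ) ⊆
        Function.support (fun u : ℝ => Real.log (1 + u) * u ^ (-α - 1)) ∩ Set.Ioi 0 :=
      fun u hu => ⟨(hpos u hu).ne', hu⟩
    exact lt_of_lt_of_le (by simp) (measure_mono this)
  · filter_upwards [ae_restrict_mem measurableSet_Ioi] with u hu using (hpos u hu).le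

lemma log_one_add_mul_rpow_eq {x u : ℝ} (hx : 0 < x) (hu : 0 < u) :
    Real.log (1 + u * x) * u ^ (-α - 1) =
      x ^ (α + 1) * (Real.log (1 + x * u) * (x * u) ^ (-α - 1)) := by
  rw [Real.mul_rpow hx.le hu.le, mul_comm u x]
  have : x ^ (α + 1) * x ^ (-α - 1) = 1 := by
    rw [← Real.rpow_add hx]; simp
  linear_combination (-(Real.log (1 + x * u) * u ^ (-α - 1))) * this

lemma integrableOn_log_one_add_mul (hα : α ∈ Set.Ioo (0 : ℝ) 1) {x : ℝ} (hx : 0 < x) :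
    IntegrableOn (fun u : ℝ => Real.log (1 + u * x) * u ^ (-α - 1)) (Set.Ioi 0) := by
  refine IntegrableOn.congr_fun ?_ (fun u hu => (log_one_add_mul_rpow_eq hx hu).symm)
    measurableSet_Ioi
  refine Integrable.const_mul ?_ _
  have := (integrableOn_Ioi_comp_mul_left_iff
    (fun u : ℝ => Real.log (1 + u) * u ^ (-α - 1)) 0 hx).2
  rw [mul_zero] at this
  exact this (integrableOn_log_one_add_mul_rpow hα)

lemma integral_log_one_add_mul {x : ℝ} (hx : 0 < x) :
    ∫ u in Set.Ioi (0 : ℝ), Real.log (1 + u * x) * u ^ (-α - 1) = logRpowConst α * x ^ α := by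
  rw [setIntegral_congr_fun measurableSet_Ioi fun u hu => log_one_add_mul_rpow_eq hx hu,
    integral_const_mul,
    integral_comp_mul_left_Ioi (fun u : ℝ => Real.log (1 + u) * u ^ (-α - 1)) 0 hx, mul_zero,
    smul_eq_mul, Real.rpow_add_one hx.ne']
  unfold logRpowConst
  field_simp

end RpowIntegral

lemma Matrix.IsHermitian.norm_det_one_add_smul {n : ℕ} {X : Matrix (Fin n) (Fin n) ℂ}
    (hX : X.IsHermitian) {u : ℝ} (hu : ∀ i, 0 ≤ 1 + u * hX.eigenvalues i) :
    ‖(1 + u • X).det‖ = ∏ i, (1 + u * hX.eigenvalues i) := by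
  obtain ⟨U, -, -, hUU, hU⟩ := hX.exists_unitary_diagonal
  have h1 : ‖U.det‖ ^ 2 = 1 := by
    simpa [hUU] using (norm_det_congr U 1).symm
  have h2 : 1 + u • X = U * diagonal (fun i => ((1 + u * hX.eigenvalues i : ℝ) : ℂ)) * Uᴴ := by
    have : diagonal (fun i => ((1 + u * hX.eigenvalues i : ℝ) : ℂ)) =
        1 + u • diagonal (fun i => (hX.eigenvalues i : ℂ)) := by
      rw [← diagonal_one, ← diagonal_smul, diagonal_add]
      congr 1; ext i; simp
    conv_lhs => rw [hU]
    rw [this, mul_add, add_mul, Matrix.mul_one, hUU, Matrix.mul_smul, Matrix.smul_mul]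
  rw [h2, norm_det_congr, h1, one_mul, norm_det_diagonal_ofReal hu]

section Tsallis

variable {d : ℕ} {α : ℝ} {X Y Z : Matrix (Fin d) (Fin d) ℂ}

lemma log_norm_det_one_add_smul (hX : X.PosDef) {u : ℝ} (hu : 0 < u) :
    Real.log ‖(1 + u • X).det‖ = ∑ i, Real.log (1 + u * hX.isHermitian.eigenvalues i) := by
  have h : ∀ i, 0 < 1 + u * hX.isHermitian.eigenvalues i := fun i => by
    have := hX.eigenvalues_pos i
    positivity
  rw [hX.isHermitian.norm_det_one_add_smul fun i => (h i).le, Real.log_prod fun i _ => (h i).ne']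

lemma integrableOn_log_norm_det (hα : α ∈ Set.Ioo (0 : ℝ) 1) (hX : X.PosDef) :
    IntegrableOn (fun u : ℝ => Real.log ‖(1 + u • X).det‖ * u ^ (-α - 1)) (Set.Ioi 0) := by
  refine IntegrableOn.congr_fun (f := fun u : ℝ =>
    ∑ i, Real.log (1 + u * hX.isHermitian.eigenvalues i) * u ^ (-α - 1)) ?_ (fun u hu => ?_)
    measurableSet_Ioi
  · exact integrable_finsetSum _ fun i _ => integrableOn_log_one_add_mul hα (hX.eigenvalues_pos i)
  · rw [log_norm_det_one_add_smul hX hu, Finset.sum_mul]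

/-- `tr X ^ α` as an integral of log-determinants. -/
lemma integral_log_norm_det (hα : α ∈ Set.Ioo (0 : ℝ) 1) (hX : X.PosDef) :
    ∫ u in Set.Ioi (0 : ℝ), Real.log ‖(1 + u • X).det‖ * u ^ (-α - 1) =
      logRpowConst α * traceF (fun x => x ^ α) X := by
  have h : ∀ u ∈ Set.Ioi (0 : ℝ), Real.log ‖(1 + u • X).det‖ * u ^ (-α - 1) =
      ∑ i, Real.log (1 + u * hX.isHermitian.eigenvalues i) * u ^ (-α - 1) := fun u hu => by
    rw [log_norm_det_one_add_smul hX hu, Finset.sum_mul]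
  rw [setIntegral_congr_fun measurableSet_Ioi h, integral_finsetSum _ fun i _ =>
    integrableOn_log_one_add_mul hα (hX.eigenvalues_pos i), traceF, dif_pos hX.isHermitian,
    Finset.mul_sum]
  exact Finset.sum_congr rfl fun i _ => integral_log_one_add_mul (hX.eigenvalues_pos i)

/-- The Jensen divergence of `X ↦ tr X ^ α`. -/
noncomputable def jensenTsallis (α : ℝ) (X Y : Matrix (Fin d) (Fin d) ℂ) : ℝ :=
  traceF (fun x => x ^ α) ((1 / 2 : ℝ) • (X + Y)) - traceF (fun x => x ^ α) X / 2 -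
    traceF (fun x => x ^ α) Y / 2

lemma Matrix.PosDef.midpoint (hX : X.PosDef) (hY : Y.PosDef) :
    ((1 / 2 : ℝ) • (X + Y)).PosDef :=
  (hX.add hY).smul (by norm_num)

lemma Matrix.PosDef.one_add_smul (hX : X.PosDef) {u : ℝ} (hu : 0 < u) :
    (1 + u • X).PosDef :=
  PosDef.one.add (hX.smul hu)

lemma sDivergence_one_add_smul (hX : X.PosDef) (hY : Y.PosDef) {u : ℝ} (hu : 0 < u) :
    sDivergence (1 + u • X) (1 + u • Y) =
      Real.log ‖(1 + u • ((1 / 2 : ℝ) • (X + Y))).det‖ - Real.log ‖(1 + u • X).det‖ / 2 -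
        Real.log ‖(1 + u • Y).det‖ / 2 := by
  have h : (1 + u • X) + (1 + u • Y) = (2 : ℂ) • (1 + u • ((1 / 2 : ℝ) • (X + Y))) := by
    ext i j
    simp
    ring
  unfold sDivergence
  rw [h, det_smul, norm_mul, Real.log_mul (by simp)
    ((hX.midpoint hY).one_add_smul hu).norm_det_pos.ne']
  simp

lemma integrableOn_sDivergence (hα : α ∈ Set.Ioo (0 : ℝ) 1) (hX : X.PosDef) (hY : Y.PosDef) :
    IntegrableOn (fun u : ℝ => sDivergence (1 + u • X) (1 + u • Y) * u ^ (-α - 1))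
      (Set.Ioi 0) := by
  refine IntegrableOn.congr_fun (((integrableOn_log_norm_det hα (hX.midpoint hY)).sub
    ((integrableOn_log_norm_det hα hX).div_const 2)).sub
    ((integrableOn_log_norm_det hα hY).div_const 2)) (fun u hu => ?_) measurableSet_Ioi
  simp only [Pi.sub_apply]
  rw [sDivergence_one_add_smul hX hY hu]
  ring

lemma integral_sDivergence (hα : α ∈ Set.Ioo (0 : ℝ) 1) (hX : X.PosDef) (hY : Y.PosDef) :
    ∫ u in Set.Ioi (0 : ℝ), sDivergence (1 + u • X) (1 + u • Y) * u ^ (-α - 1) =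
      logRpowConst α * jensenTsallis α X Y := by
  have h : ∀ u ∈ Set.Ioi (0 : ℝ), sDivergence (1 + u • X) (1 + u • Y) * u ^ (-α - 1) =
      Real.log ‖(1 + u • ((1 / 2 : ℝ) • (X + Y))).det‖ * u ^ (-α - 1) -
        Real.log ‖(1 + u • X).det‖ * u ^ (-α - 1) / 2 -
        Real.log ‖(1 + u • Y).det‖ * u ^ (-α - 1) / 2 := fun u hu => by
    rw [sDivergence_one_add_smul hX hY hu]; ring
  have iX := (integrableOn_log_norm_det hα hX).div_const 2
  have iY := (integrableOn_log_norm_det hα hY).div_const 2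
  have iM := integrableOn_log_norm_det hα (hX.midpoint hY)
  have iMX : IntegrableOn (fun u : ℝ =>
      Real.log ‖(1 + u • ((1 / 2 : ℝ) • (X + Y))).det‖ * u ^ (-α - 1) -
        Real.log ‖(1 + u • X).det‖ * u ^ (-α - 1) / 2) (Set.Ioi 0) := iM.sub iX
  rw [setIntegral_congr_fun measurableSet_Ioi h, integral_sub iMX iY, integral_sub iM iX,
    integral_div, integral_div, integral_log_norm_det hα hX, integral_log_norm_det hα hY,
    integral_log_norm_det hα (hX.midpoint hY), jensenTsallis]
  ring

lemma jensenTsallis_triangle (hα : α ∈ Set.Ioo (0 : ℝ) 1) (hX : X.PosDef) (hY : Y.PosDef)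
    (hZ : Z.PosDef) {a b : ℝ} (ha : 0 ≤ a) (hb : 0 ≤ b) :
    a * b * jensenTsallis α X Z ≤
      (a + b) * (a * jensenTsallis α X Y + b * jensenTsallis α Y Z) := by
  refine le_of_mul_le_mul_left ?_ (logRpowConst_pos hα)
  calc logRpowConst α * (a * b * jensenTsallis α X Z)
      = a * b * (logRpowConst α * jensenTsallis α X Z) := by ring
    _ ≤ (a + b) * (a * (logRpowConst α * jensenTsallis α X Y) +
        b * (logRpowConst α * jensenTsallis α Y Z)) := by
      have iXY := (integrableOn_sDivergence hα hX hY).const_mul a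
      have iYZ := (integrableOn_sDivergence hα hY hZ).const_mul b
      have iXZ := integrableOn_sDivergence hα hX hZ
      rw [← integral_sDivergence hα hX hZ, ← integral_sDivergence hα hX hY,
        ← integral_sDivergence hα hY hZ, ← integral_const_mul, ← integral_const_mul,
        ← integral_const_mul, ← integral_add iXY iYZ, ← integral_const_mul]
      refine setIntegral_mono_on (iXZ.const_mul _) ((iXY.add iYZ).const_mul _) measurableSet_Ioi
        fun u hu => ?_
      have := mul_le_mul_of_nonneg_right ((hX.one_add_smul hu).sDivergence_triangle
        (hY.one_add_smul hu) (hZ.one_add_smul hu) ha hb) (Real.rpow_nonneg (le_of_lt hu) (-α - 1))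
      refine Eq.trans_le ?_ (this.trans_eq ?_) <;> ring
    _ = _ := by ring

lemma jensenTsallis_comm (α : ℝ) (X Y : Matrix (Fin d) (Fin d) ℂ) :
    jensenTsallis α X Y = jensenTsallis α Y X := by
  unfold jensenTsallis; rw [add_comm X Y]; ring

lemma jensenTsallis_self (α : ℝ) (X : Matrix (Fin d) (Fin d) ℂ) : jensenTsallis α X X = 0 := by
  have : (1 / 2 : ℝ) • (X + X) = X := by rw [← two_smul ℝ X, smul_smul]; norm_num
  unfold jensenTsallis; rw [this]; ring

lemma jensenTsallis_nonneg (hα : α ∈ Set.Ioo (0 : ℝ) 1) (hX : X.PosDef) (hY : Y.PosDef) :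
    0 ≤ jensenTsallis α X Y := by
  have := jensenTsallis_triangle hα hX hY hX zero_le_one zero_le_one
  rw [jensenTsallis_self, jensenTsallis_comm α Y X] at this
  linarith

lemma eq_of_jensenTsallis_nonpos (hα : α ∈ Set.Ioo (0 : ℝ) 1) (hX : X.PosDef) (hY : Y.PosDef)
    (h : jensenTsallis α X Y ≤ 0) : X = Y := by
  by_contra hne
  have hpos : ∀ u ∈ Set.Ioi (0 : ℝ), 0 < sDivergence (1 + u • X) (1 + u • Y) * u ^ (-α - 1) := by
    intro u hu
    refine mul_pos ?_ (Real.rpow_pos_of_pos hu _)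
    by_contra! hle
    have := (hX.one_add_smul hu).eq_of_sDivergence_nonpos (hY.one_add_smul hu) hle
    exact hne (smul_right_injective _ (ne_of_gt hu) (add_left_cancel this))
  have : 0 < logRpowConst α * jensenTsallis α X Y := by
    rw [← integral_sDivergence hα hX hY, setIntegral_pos_iff_support_of_nonneg_ae _
      (integrableOn_sDivergence hα hX hY)]
    · have : Set.Ioi (0 : ℝ) ⊆ Function.support (fun u : ℝ =>
          sDivergence (1 + u • X) (1 + u • Y) * u ^ (-α - 1)) ∩ Set.Ioi 0 :=
        fun u hu => ⟨(hpos u hu).ne', hu⟩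
      exact lt_of_lt_of_le (by simp) (measure_mono this)
    · filter_upwards [ae_restrict_mem measurableSet_Ioi] with u hu using (hpos u hu).le
  nlinarith [logRpowConst_pos hα]

end Tsallis

lemma Real.sqrt_le_sqrt_add_sqrt_of_forall {x y z : ℝ} (hx : 0 ≤ x) (hy : 0 ≤ y)
    (h : ∀ a b : ℝ, 0 < a → 0 < b → a * b * z ≤ (a + b) * (a * x + b * y)) :
    √z ≤ √x + √y := by
  refine le_of_forall_pos_le_add fun ε hε => ?_
  have hp := Real.sqrt_nonneg x
  have hq := Real.sqrt_nonneg y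
  have hpx := Real.sq_sqrt hx
  have hqy := Real.sq_sqrt hy
  set p := √x
  set q := √y
  have ha : 0 < q + ε / 2 := by positivity
  have hb : 0 < p + ε / 2 := by positivity
  have h1 := h _ _ ha hb
  set a := q + ε / 2 with ha'
  set b := p + ε / 2 with hb'
  have h2 : (a + b) * (a * x + b * y) ≤ (a + b) * (a * b ^ 2 + b * a ^ 2) := by
    rw [← hpx, ← hqy]
    gcongr <;> linarith
  have h3 : z ≤ (a + b) ^ 2 := by
    refine le_of_mul_le_mul_left ?_ (mul_pos ha hb)
    linarith
  rw [show p + q + ε = a + b by rw [ha', hb']; ring]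
  exact Real.sqrt_le_iff.2 ⟨by positivity, h3⟩

/-- The triangle inequality for `arcosh C`, where `C` is the Gram matrix of three points on a
hyperboloid. -/
lemma Real.le_cosh_add_of_forall {u v C : ℝ} (hu : 0 ≤ u) (hv : 0 ≤ v)
    (h : ∀ s t : ℝ, 0 < s → 0 < t →
      s ^ 2 + t ^ 2 + 2 * s * t * C ≤ (s * Real.cosh u + t * Real.cosh v) ^ 2) :
    C ≤ Real.cosh (u + v) := by
  have hsu := Real.sinh_nonneg_iff.2 hu
  have hsv := Real.sinh_nonneg_iff.2 hv
  have hε : ∀ ε : ℝ, 0 < ε → C ≤ Real.cosh u * Real.cosh v +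
      (Real.sinh u + ε) * (Real.sinh v + ε) := by
    intro ε hε
    have h1 := h (Real.sinh v + ε) (Real.sinh u + ε) (by positivity) (by positivity)
    have hcu := Real.cosh_sq u
    have hcv := Real.cosh_sq v
    set S := Real.sinh u + ε with hS
    set T := Real.sinh v + ε with hT
    have hS0 : 0 < S := by positivity
    have hT0 : 0 < T := by positivity
    have h2 : Real.sinh u ^ 2 ≤ S ^ 2 := by gcongr; linarith
    have h3 : Real.sinh v ^ 2 ≤ T ^ 2 := by gcongr; linarith
    have h4 : T ^ 2 * Real.sinh u ^ 2 ≤ T ^ 2 * S ^ 2 := by gcongr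
    have h5 : S ^ 2 * Real.sinh v ^ 2 ≤ S ^ 2 * T ^ 2 := by gcongr
    refine le_of_mul_le_mul_left ?_ (mul_pos hS0 hT0)
    have h6 : (T * Real.cosh u + S * Real.cosh v) ^ 2 = T ^ 2 * (Real.sinh u ^ 2 + 1) +
        S ^ 2 * (Real.sinh v ^ 2 + 1) + 2 * S * T * (Real.cosh u * Real.cosh v) := by
      rw [← hcu, ← hcv]; ring
    nlinarith
  rw [Real.cosh_add]
  have hlim : Filter.Tendsto (fun ε : ℝ => Real.cosh u * Real.cosh v +
      (Real.sinh u + ε) * (Real.sinh v + ε)) (nhdsWithin 0 (Set.Ioi 0))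
      (nhds (Real.cosh u * Real.cosh v + (Real.sinh u + 0) * (Real.sinh v + 0))) :=
    (Continuous.tendsto (by fun_prop) 0).mono_left nhdsWithin_le_nhds
  rw [add_zero, add_zero] at hlim
  refine ge_of_tendsto hlim ?_
  filter_upwards [self_mem_nhdsWithin] with ε hε0 using hε ε hε0

/-- If a kernel on three points has a Jensen divergence whose square root satisfies the triangle
inequality, then so does the logarithm of the kernel. -/
lemma Real.sqrt_log_jensen_triangle {p q r k l m : ℝ} (hp : 0 < p) (hq : 0 < q) (hr : 0 < r)
    (hk : (p + q) / 2 ≤ k) (hl : (q + r) / 2 ≤ l) (hm : 0 < m)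
    (h : ∀ a b : ℝ, 0 ≤ a → 0 ≤ b → a * b * (m - p / 2 - r / 2) ≤
      (a + b) * (a * (k - p / 2 - q / 2) + b * (l - q / 2 - r / 2))) :
    √(Real.log m - Real.log p / 2 - Real.log r / 2) ≤
      √(Real.log k - Real.log p / 2 - Real.log q / 2) +
        √(Real.log l - Real.log q / 2 - Real.log r / 2) := by
  obtain ⟨x, hx, rfl⟩ : ∃ x : ℝ, 0 < x ∧ x ^ 2 = p := ⟨√p, Real.sqrt_pos.2 hp, Real.sq_sqrt hp.le⟩
  obtain ⟨y, hy, rfl⟩ : ∃ y : ℝ, 0 < y ∧ y ^ 2 = q := ⟨√q, Real.sqrt_pos.2 hq, Real.sq_sqrt hq.le⟩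
  obtain ⟨z, hz, rfl⟩ : ∃ z : ℝ, 0 < z ∧ z ^ 2 = r := ⟨√r, Real.sqrt_pos.2 hr, Real.sq_sqrt hr.le⟩
  have hlog : ∀ {s t n : ℝ}, 0 < s → 0 < t → 0 < n →
      Real.log n - Real.log (s ^ 2) / 2 - Real.log (t ^ 2) / 2 = Real.log (n / (s * t)) := by
    intro s t n hs ht hn
    rw [Real.log_div hn.ne' (by positivity), Real.log_mul hs.ne' ht.ne', Real.log_pow,
      Real.log_pow]
    push_cast; ring
  have hcosh : ∀ {s t n : ℝ}, 0 < s → 0 < t → (s ^ 2 + t ^ 2) / 2 ≤ n →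
      0 < n ∧ ∃ u, 0 ≤ u ∧ Real.cosh u = n / (s * t) := by
    intro s t n hs ht hn
    refine ⟨lt_of_lt_of_le (by positivity) hn, Real.arcosh (n / (s * t)), ?_, ?_⟩
    · refine Real.arcosh_nonneg ?_
      rw [one_le_div (by positivity)]
      nlinarith [sq_nonneg (s - t)]
    · refine Real.cosh_arcosh ?_
      rw [one_le_div (by positivity)]
      nlinarith [sq_nonneg (s - t)]
  obtain ⟨hk0, u, hu, hku⟩ := hcosh hx hy hk
  obtain ⟨hl0, v, hv, hlv⟩ := hcosh hy hz hl
  rw [hlog hx hz hm, hlog hx hy hk0, hlog hy hz hl0, ← hku, ← hlv]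
  have hC : m / (x * z) ≤ Real.cosh (u + v) := by
    refine Real.le_cosh_add_of_forall hu hv fun s t hs ht => ?_
    have h1 := h (s / x) (t / z) (by positivity) (by positivity)
    rw [hku, hlv]
    have h2 : s ^ 2 + t ^ 2 + 2 * s * t * (m / (x * z)) - (s * (k / (x * y)) + t * (l / (y * z))) ^ 2
        + ((s / x + t / z) * y - s * (k / (x * y)) - t * (l / (y * z))) ^ 2 =
        2 * (s / x * (t / z) * (m - x ^ 2 / 2 - z ^ 2 / 2) -
          (s / x + t / z) * (s / x * (k - x ^ 2 / 2 - y ^ 2 / 2) +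
            t / z * (l - y ^ 2 / 2 - z ^ 2 / 2))) := by
      field_simp
      ring
    nlinarith [sq_nonneg ((s / x + t / z) * y - s * (k / (x * y)) - t * (l / (y * z)))]
  refine (Real.sqrt_le_sqrt (Real.log_le_log (by positivity) hC)).trans ?_
  exact Real.sqrt_le_sqrt_add_sqrt_of_forall (Real.log_nonneg (Real.one_le_cosh u))
    (Real.log_nonneg (Real.one_le_cosh v)) fun a b ha hb =>
      Real.log_cosh_add_le ha.le hb.le hu hv

lemma traceF_rpow_pos {d : ℕ} {α : ℝ} {X : Matrix (Fin d) (Fin d) ℂ} (hX : X.PosDef)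
    (htX : X.trace = 1) : 0 < traceF (fun x => x ^ α) X := by
  have : Nonempty (Fin d) := by
    by_contra hne
    rw [not_nonempty_iff] at hne
    simp [trace] at htX
  rw [traceF, dif_pos hX.isHermitian]
  exact Finset.sum_pos (fun i _ => Real.rpow_pos_of_pos (hX.eigenvalues_pos i) _)
    Finset.univ_nonempty

lemma Matrix.trace_midpoint {d : ℕ} {X Y : Matrix (Fin d) (Fin d) ℂ} (htX : X.trace = 1)
    (htY : Y.trace = 1) : ((1 / 2 : ℝ) • (X + Y)).trace = 1 := by
  rw [trace_smul, trace_add, htX, htY]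
  apply Complex.ext <;> norm_num

lemma qjrd_eq {d : ℕ} (α : ℝ) {X Y : Matrix (Fin d) (Fin d) ℂ}
    (htX : X.trace = 1) (htY : Y.trace = 1) :
    qjrd α X Y = (1 / (1 - α)) * (Real.log (traceF (fun x => x ^ α) ((1 / 2 : ℝ) • (X + Y))) -
      Real.log (traceF (fun x => x ^ α) X) / 2 - Real.log (traceF (fun x => x ^ α) Y) / 2) := by
  unfold qjrd renyiEntropy
  rw [trace_midpoint htX htY, htX, htY]
  simp only [Complex.one_re, div_one]
  ring

/-- For `α ∈ (0,1)`, `√(QJRD_α)` is a metric on the set of `d×d` Hermitian positive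
definite matrices of unit trace. -/
theorem qjrd_sqrt_metric {d : ℕ} (α : ℝ) (hα : α ∈ Set.Ioo (0:ℝ) 1)
    (X Y Z : Matrix (Fin d) (Fin d) ℂ) (hX : X.PosDef) (hY : Y.PosDef) (hZ : Z.PosDef)
    (htX : X.trace = 1) (htY : Y.trace = 1) (htZ : Z.trace = 1) :
    0 ≤ qjrd α X Y ∧
    (qjrd α X Y = 0 ↔ X = Y) ∧
    qjrd α X Y = qjrd α Y X ∧
    Real.sqrt (qjrd α X Z) ≤ Real.sqrt (qjrd α X Y) + Real.sqrt (qjrd α Y Z) := by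
  have hα1 : 0 < 1 / (1 - α) := one_div_pos.2 (sub_pos.2 hα.2)
  have hTX := traceF_rpow_pos (α := α) hX htX
  have hTY := traceF_rpow_pos (α := α) hY htY
  have hTZ := traceF_rpow_pos (α := α) hZ htZ
  have hJXY := jensenTsallis_nonneg hα hX hY
  have hJYZ := jensenTsallis_nonneg hα hY hZ
  have htri := fun a b : ℝ => jensenTsallis_triangle hα hX hY hZ (a := a) (b := b)
  have hTXY := traceF_rpow_pos (α := α) (hX.midpoint hY) (trace_midpoint htX htY)
  have hTXZ := traceF_rpow_pos (α := α) (hX.midpoint hZ) (trace_midpoint htX htZ)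
  have heq := eq_of_jensenTsallis_nonpos hα hX hY
  have hself : X = Y → jensenTsallis α X Y = 0 := by
    rintro rfl; exact jensenTsallis_self α X
  unfold jensenTsallis at hJXY hJYZ htri heq hself
  have hamgm : Real.log (traceF (fun x => x ^ α) X) / 2 + Real.log (traceF (fun x => x ^ α) Y) / 2 ≤
      Real.log ((traceF (fun x => x ^ α) X + traceF (fun x => x ^ α) Y) / 2) := by
    have := Real.log_nonneg (Real.one_le_cosh (Real.log (traceF (fun x => x ^ α) X) / 2 -
      Real.log (traceF (fun x => x ^ α) Y) / 2))
    rw [Real.log_cosh_half_log_sub hTX hTY] at this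
    rw [Real.log_div (by positivity) two_ne_zero]
    linarith
  have hmono := Real.log_le_log (by positivity) (show (traceF (fun x => x ^ α) X +
    traceF (fun x => x ^ α) Y) / 2 ≤ traceF (fun x => x ^ α) ((1 / 2 : ℝ) • (X + Y)) by linarith)
  refine ⟨?_, ⟨fun h => ?_, ?_⟩, ?_, ?_⟩
  · rw [qjrd_eq α htX htY]
    exact mul_nonneg hα1.le (by linarith)
  · rw [qjrd_eq α htX htY, mul_eq_zero, or_iff_right hα1.ne'] at h
    apply heq
    have := (Real.log_le_log_iff hTXY (by positivity)).1 (show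
      Real.log (traceF (fun x => x ^ α) ((1 / 2 : ℝ) • (X + Y))) ≤
        Real.log ((traceF (fun x => x ^ α) X + traceF (fun x => x ^ α) Y) / 2) by linarith)
    linarith
  · rintro rfl
    rw [qjrd_eq α htX htX, show traceF (fun x => x ^ α) ((1 / 2 : ℝ) • (X + X)) =
      traceF (fun x => x ^ α) X by linarith [hself rfl]]
    ring
  · unfold qjrd
    rw [add_comm X Y]; ring
  · rw [qjrd_eq α htX htY, qjrd_eq α htX htZ, qjrd_eq α htY htZ, Real.sqrt_mul hα1.le,
      Real.sqrt_mul hα1.le, Real.sqrt_mul hα1.le, ← mul_add]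
    exact mul_le_mul_of_nonneg_left (Real.sqrt_log_jensen_triangle hTX hTY hTZ (by linarith)
      (by linarith) hTXZ htri) (Real.sqrt_nonneg _)
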